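/- Let β = 2^(t−1) with t ≥ 3 (so β ≥ 4), and let C₁ and C₂ be quaternary linear perfect codes of length β of dual type (0,β;γ₁,δ₁) and (0,β;γ₂,δ₂) respectively, such that C₁ ∩ C₂ is of dual type (0,β;i,j). Then for each (i',j') ∈ {(i,j+1), (i,j+2), (i+1,j+1)} there exist two quaternary linear perfect codes of length 4β of dual type (0,4β;γ₁,δ₁+1) and (0,4β;γ₂,δ₂+1) respectively whose intersection is of dual type (0,4β;i',j'). -/

import Mathlib

open scoped BigOperators

/-- `Z2` is the ring of integers modulo 2. -/
abbrev Z2 : Type := ZMod 2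

/-- `Z4` is the ring of integers modulo 4. -/
abbrev Z4 : Type := ZMod 4

/-- The ambient group `Z₂^α × Z₄^β` for additive codes. -/
abbrev Amb (α β : ℕ) : Type := (Fin α → Z2) × (Fin β → Z4)

/-- The inner product on `Z₂^α × Z₄^β`:
`⟨u,v⟩ = 2·(Σᵢ ūᵢ·v̄ᵢ) + Σⱼ uⱼ·vⱼ ∈ Z₄`, where the bar denotes the lift `0 ↦ 0`, `1 ↦ 1`
of binary coordinates into `Z₄`. -/
def addInner {α β : ℕ} (u v : Amb α β) : Z4 :=
  2 * (∑ i, ((u.1 i).val : Z4) * ((v.1 i).val : Z4)) + ∑ j, u.2 j * v.2 j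

lemma addInner_zero_left {α β : ℕ} (v : Amb α β) : addInner 0 v = 0 := by
  simp [addInner]

lemma addInner_add_left {α β : ℕ} (u u' v : Amb α β) :
    addInner (u + u') v = addInner u v + addInner u' v := by
  have key : ∀ x x' y : Z2,
      (2 : Z4) * ((((x + x').val : ℕ) : Z4) * ((y.val : ℕ) : Z4)) =
        2 * (((x.val : ℕ) : Z4) * ((y.val : ℕ) : Z4)) +
          2 * (((x'.val : ℕ) : Z4) * ((y.val : ℕ) : Z4)) := by decide
  simp only [addInner, Prod.fst_add, Prod.snd_add, Pi.add_apply, add_mul,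
    Finset.mul_sum, Finset.sum_add_distrib]
  rw [Finset.sum_congr rfl (fun i _ => key (u.1 i) (u'.1 i) (v.1 i)),
    Finset.sum_add_distrib]
  ring

lemma addInner_neg_left {α β : ℕ} (u v : Amb α β) :
    addInner (-u) v = - addInner u v := by
  have hn : ∀ x : Z2, (-x) = x := by decide
  have key : ∀ S T : Z4, 2 * S + -T = -(2 * S + T) := by decide
  simp only [addInner, Prod.fst_neg, Prod.snd_neg, Pi.neg_apply, hn, neg_mul]
  rw [Finset.sum_neg_distrib]
  exact key _ _

/-- The additive dual `C^⊥ = {u : ⟨u,v⟩ = 0 for all v ∈ C}` of an additive code `C`. -/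
def dualCode {α β : ℕ} (C : AddSubgroup (Amb α β)) : AddSubgroup (Amb α β) where
  carrier := {u | ∀ v ∈ C, addInner u v = 0}
  zero_mem' := fun v _ => addInner_zero_left v
  add_mem' := by
    intro a b ha hb v hv
    rw [addInner_add_left, ha v hv, hb v hv, add_zero]
  neg_mem' := by
    intro a ha v hv
    rw [addInner_neg_left, ha v hv, neg_zero]

/-- An additive code `C ⊆ Z₂^α × Z₄^β` is of type `(α,β;γ,δ)` when it is isomorphic,
as an abelian group, to `Z₂^γ × Z₄^δ`; equivalently (which is how we state it),
`|C| = 2^(γ+2δ)` and the number of elements `x ∈ C` with `x + x = 0` is `2^(γ+δ)`. -/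
def isOfType {α β : ℕ} (C : AddSubgroup (Amb α β)) (γ δ : ℕ) : Prop :=
  Nat.card C = 2 ^ (γ + 2 * δ) ∧
    Nat.card {x : Amb α β // x ∈ C ∧ x + x = 0} = 2 ^ (γ + δ)

/-- An additive code `C` is of type `(α,β;γ,δ;κ)` when it is of type `(α,β;γ,δ)` and
`2^κ` is the cardinality of the image of `{x ∈ C : x + x = 0}` under the projection
onto the binary coordinates. -/
def isOfTypeK {α β : ℕ} (C : AddSubgroup (Amb α β)) (γ δ κ : ℕ) : Prop :=
  isOfType C γ δ ∧
    Nat.card ↥(Prod.fst '' {x : Amb α β | x ∈ C ∧ x + x = 0}) = 2 ^ κ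

/-- The Gray map on one quaternary coordinate:
`0 ↦ (0,0)`, `1 ↦ (0,1)`, `2 ↦ (1,1)`, `3 ↦ (1,0)`. -/
def grayPhi (y : Z4) : Z2 × Z2 :=
  if y = 0 then (0, 0) else if y = 1 then (0, 1) else if y = 2 then (1, 1) else (1, 0)

/-- The Gray map `Φ : Z₂^α × Z₄^β → Z₂^(α+2β)` (with index set `Fin α ⊕ Fin β × Fin 2`),
acting as the identity on the binary coordinates and as `grayPhi` coordinatewise on the
quaternary coordinates. -/
def grayMap {α β : ℕ} (u : Amb α β) : (Fin α ⊕ Fin β × Fin 2) → Z2 :=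
  Sum.elim (fun a => u.1 a)
    (fun b => if b.2 = 0 then (grayPhi (u.2 b.1)).1 else (grayPhi (u.2 b.1)).2)

/-- The minimum Hamming distance of a binary code `S` equals `d`. -/
def minDistEq {ι : Type} [Fintype ι] (S : Set (ι → Z2)) (d : ℕ) : Prop :=
  (∀ x ∈ S, ∀ y ∈ S, x ≠ y → d ≤ hammingDist x y) ∧
    ∃ x ∈ S, ∃ y ∈ S, x ≠ y ∧ hammingDist x y = d

/-- A quaternary linear perfect code of length `β = 2^(t-1)` (`t ≥ 3`): an additive
subgroup of `Z₄^β` whose Gray image has cardinality `2^(2β-t-1)` and minimum Hamming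
distance `4`. -/
def isQuatPerfect (t β : ℕ) (C : AddSubgroup (Amb 0 β)) : Prop :=
  3 ≤ t ∧ β = 2 ^ (t - 1) ∧
    Nat.card ↥(grayMap '' (C : Set (Amb 0 β))) = 2 ^ (2 * β - t - 1) ∧
    minDistEq (grayMap '' (C : Set (Amb 0 β))) 4

/-- An additive extended perfect code with `α ≠ 0` and binary length `α + 2β = 2^t`:
an additive subgroup of `Z₂^α × Z₄^β` with `α ≥ 1` whose Gray image has cardinality
`2^(2^t - t - 1)` and minimum Hamming distance `4`. -/
def isAddExtPerfect (t α β : ℕ) (C : AddSubgroup (Amb α β)) : Prop :=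
  1 ≤ α ∧ α + 2 * β = 2 ^ t ∧
    Nat.card ↥(grayMap '' (C : Set (Amb α β))) = 2 ^ (2 ^ t - t - 1) ∧
    minDistEq (grayMap '' (C : Set (Amb α β))) 4

section DirectSums

variable {M : Type*} [AddCommGroup M] {A B : AddSubgroup M}

lemma card_sup_of_disjoint (h : Disjoint A B) :
    Nat.card ↥(A ⊔ B) = Nat.card A * Nat.card B := by
  rw [← Nat.card_prod]
  refine (Nat.card_congr (Equiv.ofBijective
    (fun p : A × B => (⟨p.1 + p.2, AddSubgroup.add_mem_sup p.1.2 p.2.2⟩ : ↥(A ⊔ B)))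
    ⟨?_, ?_⟩)).symm
  · intro p q hpq
    exact AddSubgroup.add_injective_of_disjoint h (congrArg Subtype.val hpq)
  · rintro ⟨x, hx⟩
    obtain ⟨a, ha, b, hb, rfl⟩ := AddSubgroup.mem_sup.1 hx
    exact ⟨(⟨a, ha⟩, ⟨b, hb⟩), rfl⟩

/-- The elements of `A` killed by doubling. -/
def twoTorsion (A : AddSubgroup M) : AddSubgroup M where
  carrier := {x | x ∈ A ∧ x + x = 0}
  zero_mem' := ⟨A.zero_mem, add_zero 0⟩
  add_mem' := by
    rintro x y ⟨hx, hx'⟩ ⟨hy, hy'⟩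
    exact ⟨A.add_mem hx hy, by rw [add_add_add_comm, hx', hy', add_zero]⟩
  neg_mem' := by
    rintro x ⟨hx, hx'⟩
    exact ⟨A.neg_mem hx, by rw [← neg_add, hx', neg_zero]⟩

lemma mem_twoTorsion {x : M} : x ∈ twoTorsion A ↔ x ∈ A ∧ x + x = 0 := Iff.rfl

lemma twoTorsion_sup_of_disjoint (h : Disjoint A B) :
    twoTorsion (A ⊔ B) = twoTorsion A ⊔ twoTorsion B := by
  ext x
  constructor
  · rintro ⟨hx, hx2⟩
    obtain ⟨a, ha, b, hb, rfl⟩ := AddSubgroup.mem_sup.1 hx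
    have hab : (a + a) + (b + b) = 0 := by rw [← add_add_add_comm, hx2]
    have haa : a + a = 0 := AddSubgroup.disjoint_def.1 h (A.add_mem ha ha)
      (by rw [eq_neg_of_add_eq_zero_left hab]; exact B.neg_mem (B.add_mem hb hb))
    rw [haa, zero_add] at hab
    exact AddSubgroup.add_mem_sup ⟨ha, haa⟩ ⟨hb, hab⟩
  · intro hx
    obtain ⟨a, ⟨ha, ha2⟩, b, ⟨hb, hb2⟩, rfl⟩ := AddSubgroup.mem_sup.1 hx
    exact ⟨AddSubgroup.add_mem_sup ha hb, by rw [add_add_add_comm, ha2, hb2, add_zero]⟩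

end DirectSums

section Types

variable {α β : ℕ}

lemma isOfType_iff {C : AddSubgroup (Amb α β)} {γ δ : ℕ} :
    isOfType C γ δ ↔
      Nat.card C = 2 ^ (γ + 2 * δ) ∧ Nat.card (twoTorsion C) = 2 ^ (γ + δ) := Iff.rfl

lemma isOfType.sup {A B : AddSubgroup (Amb α β)} {γ δ γ' δ' : ℕ} (hA : isOfType A γ δ)
    (hB : isOfType B γ' δ') (h : Disjoint A B) : isOfType (A ⊔ B) (γ + γ') (δ + δ') := by
  rw [isOfType_iff] at *
  have h' : Disjoint (twoTorsion A) (twoTorsion B) :=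
    h.mono (fun _ hx => hx.1) (fun _ hx => hx.1)
  rw [card_sup_of_disjoint h, twoTorsion_sup_of_disjoint h, card_sup_of_disjoint h',
    hA.1, hA.2, hB.1, hB.2]
  constructor <;> ring

lemma isOfType.map {α' β' : ℕ} {A : AddSubgroup (Amb α β)} {γ δ : ℕ} (hA : isOfType A γ δ)
    {f : Amb α β →+ Amb α' β'} (hf : Function.Injective f) : isOfType (A.map f) γ δ := by
  rw [isOfType_iff] at *
  have hT : twoTorsion (A.map f) = (twoTorsion A).map f := by
    ext x
    constructor
    · rintro ⟨⟨a, ha, rfl⟩, h⟩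
      exact ⟨a, ⟨ha, hf (by rw [map_add, h, map_zero])⟩, rfl⟩
    · rintro ⟨a, ⟨ha, h⟩, rfl⟩
      exact ⟨⟨a, ha, rfl⟩, by rw [← map_add, h, map_zero]⟩
  rw [hT, Nat.card_congr (A.equivMapOfInjective f hf).symm.toEquiv,
    Nat.card_congr ((twoTorsion A).equivMapOfInjective f hf).symm.toEquiv]
  exact hA

lemma isOfType_zmultiples_of_order_two {w : Amb α β} (h2 : (2 : ℕ) • w = 0) (h0 : w ≠ 0) :
    isOfType (AddSubgroup.zmultiples w) 1 0 := by
  have ho : addOrderOf w = 2 := addOrderOf_eq_prime h2 h0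
  have hT : twoTorsion (AddSubgroup.zmultiples w) = AddSubgroup.zmultiples w := by
    ext x
    rw [mem_twoTorsion, and_iff_left_iff_imp]
    rintro ⟨n, rfl⟩
    simp only [← two_nsmul]
    rw [smul_comm, h2, smul_zero]
  rw [isOfType_iff, hT, Nat.card_zmultiples, ho]
  simp

lemma isOfType_zmultiples_of_order_four {w : Amb α β} (h4 : (4 : ℕ) • w = 0)
    (h2 : (2 : ℕ) • w ≠ 0) : isOfType (AddSubgroup.zmultiples w) 0 1 := by
  have ho : addOrderOf w = 4 :=
    addOrderOf_eq_prime_pow (p := 2) (n := 1) (by simpa using h2) (by simpa using h4)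
  have ho2 : addOrderOf ((2 : ℕ) • w) = 2 :=
    addOrderOf_eq_prime (by rw [smul_smul]; exact h4) h2
  have hT : twoTorsion (AddSubgroup.zmultiples w) = AddSubgroup.zmultiples ((2 : ℕ) • w) := by
    ext x
    rw [mem_twoTorsion, AddSubgroup.mem_zmultiples_iff, AddSubgroup.mem_zmultiples_iff]
    constructor
    · rintro ⟨⟨n, rfl⟩, h⟩
      rw [← add_smul, ← addOrderOf_dvd_iff_zsmul_eq_zero, ho] at h
      obtain ⟨m, rfl⟩ : (2 : ℤ) ∣ n := by omega
      exact ⟨m, by rw [← natCast_zsmul, smul_smul, mul_comm]; rfl⟩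
    · rintro ⟨m, rfl⟩
      refine ⟨⟨m * 2, by rw [← natCast_zsmul, smul_smul]; rfl⟩, ?_⟩
      rw [← smul_add, ← two_nsmul, smul_smul, show (2 * 2 : ℕ) • w = 0 from h4, smul_zero]
  rw [isOfType_iff, hT, Nat.card_zmultiples, Nat.card_zmultiples, ho, ho2]
  simp

lemma disjoint_zmultiples_of_order_two {A : AddSubgroup (Amb α β)} {w : Amb α β}
    (h2 : (2 : ℕ) • w = 0) (hw : w ∉ A) : Disjoint A (AddSubgroup.zmultiples w) := by
  rw [AddSubgroup.disjoint_def]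
  rintro x hx ⟨n, rfl⟩
  obtain ⟨m, rfl | rfl⟩ := Int.even_or_odd' n
  · have h2' : (2 : ℤ) • w = 0 := by exact_mod_cast h2
    simp only [mul_comm (2 : ℤ), mul_smul, h2', smul_zero]
  · have h2' : (2 : ℤ) • w = 0 := by exact_mod_cast h2
    refine absurd ?_ hw
    simpa only [add_smul, mul_comm (2 : ℤ), mul_smul, h2', smul_zero, zero_add, one_smul] using hx

lemma disjoint_zmultiples_of_order_four {A : AddSubgroup (Amb α β)} {w : Amb α β}
    (h4 : (4 : ℕ) • w = 0) (hw : (2 : ℕ) • w ∉ A) : Disjoint A (AddSubgroup.zmultiples w) := by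
  have h4' : (4 : ℤ) • w = 0 := by exact_mod_cast h4
  have hw' : (2 : ℤ) • w ∉ A := by exact_mod_cast hw
  rw [AddSubgroup.disjoint_def]
  rintro x hx ⟨n, rfl⟩
  simp only at hx ⊢
  by_cases hn : (4 : ℤ) ∣ n
  · obtain ⟨m, rfl⟩ := hn
    rw [mul_comm, mul_smul, h4', smul_zero]
  · refine absurd ?_ hw'
    obtain ⟨a, b, hab⟩ : ∃ a b : ℤ, 2 = a * n + b * 4 := by
      obtain h | h | h : n % 4 = 1 ∨ n % 4 = 2 ∨ n % 4 = 3 := by omega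
      · exact ⟨2, -2 * (n / 4), by omega⟩
      · exact ⟨1, -(n / 4), by omega⟩
      · exact ⟨2, -2 * (n / 4) - 1, by omega⟩
    rw [hab, add_smul, mul_smul, mul_smul, h4', smul_zero, add_zero]
    exact A.zsmul_mem hx a

lemma isOfType.sup_zmultiples_of_order_two {A : AddSubgroup (Amb α β)} {γ δ : ℕ}
    (hA : isOfType A γ δ) {w : Amb α β} (h2 : (2 : ℕ) • w = 0) (hw : w ∉ A) :
    isOfType (A ⊔ AddSubgroup.zmultiples w) (γ + 1) δ :=
  hA.sup (isOfType_zmultiples_of_order_two h2 (fun h => hw (h ▸ A.zero_mem)))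
    (disjoint_zmultiples_of_order_two h2 hw)

lemma isOfType.sup_zmultiples_of_order_four {A : AddSubgroup (Amb α β)} {γ δ : ℕ}
    (hA : isOfType A γ δ) {w : Amb α β} (h4 : (4 : ℕ) • w = 0) (hw : (2 : ℕ) • w ∉ A) :
    isOfType (A ⊔ AddSubgroup.zmultiples w) γ (δ + 1) :=
  hA.sup (isOfType_zmultiples_of_order_four h4 (fun h => hw (h ▸ A.zero_mem)))
    (disjoint_zmultiples_of_order_four h4 hw)

end Types

section Duality

variable {α β : ℕ}

lemma addInner_comm (u v : Amb α β) : addInner u v = addInner v u := by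
  simp only [addInner, mul_comm]

/-- The inner product with `w` as an additive character. -/
def innerHom (w : Amb α β) : Amb α β →+ Z4 where
  toFun x := addInner x w
  map_zero' := addInner_zero_left w
  map_add' x y := addInner_add_left x y w

@[simp] lemma innerHom_apply (w x : Amb α β) : innerHom w x = addInner x w := rfl

lemma exists_zmod_four_generator (S : AddSubgroup Z4) :
    ∃ d ∈ S, ∀ x ∈ S, ∃ m : ℤ, x = m • d := by
  obtain ⟨⟨d, hd⟩, h⟩ := IsAddCyclic.exists_generator (α := S)
  refine ⟨d, hd, fun x hx => ?_⟩
  obtain ⟨m, hm⟩ := h ⟨x, hx⟩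
  exact ⟨m, by simpa using (congrArg Subtype.val hm).symm⟩

/-- The dual of the intersection of a code with a hyperplane `w^⊥`. -/
lemma dualCode_inf_ker (X : AddSubgroup (Amb α β)) (w : Amb α β) :
    dualCode (X ⊓ (innerHom w).ker) = dualCode X ⊔ AddSubgroup.zmultiples w := by
  have hz : ∀ (k : ℤ) (x : Amb α β), addInner (k • w) x = k • addInner w x := fun k x => by
    rw [← innerHom_apply, map_zsmul]; rfl
  apply le_antisymm
  · intro u hu
    obtain ⟨d, ⟨x₀, hx₀, rfl⟩, hgen⟩ := exists_zmod_four_generator (X.map (innerHom w))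
    have key : ∀ m : ℤ, m • innerHom w x₀ = 0 → m • innerHom u x₀ = 0 := fun m hm => by
      rw [← map_zsmul] at hm ⊢
      rw [innerHom_apply, addInner_comm]
      exact hu _ ⟨X.zsmul_mem hx₀ m, hm⟩
    obtain ⟨a, ha⟩ : ∃ a : ℤ, innerHom u x₀ = a • innerHom w x₀ := by
      have h : ∀ d e : Z4, ((2 : ℤ) • d = 0 → (2 : ℤ) • e = 0) →
          ((1 : ℤ) • d = 0 → (1 : ℤ) • e = 0) →
          ∃ m : Fin 4, e = ((m : ℕ) : ℤ) • d := by decide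
      obtain ⟨m, hm⟩ := h _ _ (key 2) (key 1)
      exact ⟨_, hm⟩
    rw [AddSubgroup.mem_sup]
    refine ⟨u - a • w, ?_, a • w, AddSubgroup.zsmul_mem_zmultiples w a, sub_add_cancel _ _⟩
    intro x hx
    obtain ⟨c, hc⟩ := hgen _ ⟨x, hx, rfl⟩
    have hy : addInner u (x - c • x₀) = 0 :=
      hu _ ⟨X.sub_mem hx (X.zsmul_mem hx₀ c), by
        change innerHom w _ = 0
        rw [map_sub, map_zsmul, hc, sub_self]⟩
    rw [addInner_comm, ← innerHom_apply, map_sub, map_zsmul, sub_eq_zero] at hy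
    rw [sub_eq_add_neg, addInner_add_left, addInner_neg_left, hz, addInner_comm u, addInner_comm w,
      ← innerHom_apply, ← innerHom_apply, hy, hc, ha, smul_comm, add_neg_cancel]
  · refine sup_le (fun u hu x hx => hu x hx.1) ?_
    rw [AddSubgroup.zmultiples_le]
    intro x hx
    rw [addInner_comm]
    exact hx.2

end Duality

section LeeWeight

variable {β : ℕ}

/-- The Lee weight on `Z₄`. -/
def lee (a : Z4) : ℕ := min a.val (4 - a.val)

/-- The Lee weight of a quaternary vector. -/
def leeWeight (x : Amb 0 β) : ℕ := ∑ j, lee (x.2 j)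

lemma lee_eq_zero {a : Z4} : lee a = 0 ↔ a = 0 := by revert a; decide

lemma lee_add_le : ∀ a b : Z4, lee (a + b) ≤ lee a + lee b := by decide

lemma hammingDist_grayMap (x y : Amb 0 β) :
    hammingDist (grayMap x) (grayMap y) = leeWeight (x - y) := by
  have key : ∀ a b : Z4, (∑ i : Fin 2,
      if (if i = 0 then (grayPhi a).1 else (grayPhi a).2) ≠
        (if i = 0 then (grayPhi b).1 else (grayPhi b).2) then 1 else 0) = lee (a - b) := by
    decide
  rw [hammingDist, Finset.card_filter, Fintype.sum_sum_type, Fintype.sum_prod_type]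
  simp only [Finset.univ_eq_empty, Finset.sum_empty, zero_add, leeWeight]
  exact Finset.sum_congr rfl fun j _ => key (x.2 j) (y.2 j)

lemma leeWeight_zero : leeWeight (0 : Amb 0 β) = 0 :=
  Finset.sum_eq_zero fun _ _ => rfl

lemma leeWeight_eq_zero {x : Amb 0 β} : leeWeight x = 0 ↔ x = 0 := by
  refine ⟨fun h => ?_, fun h => h ▸ leeWeight_zero⟩
  rw [leeWeight, Finset.sum_eq_zero_iff] at h
  exact Prod.ext (Subsingleton.elim _ _) (funext fun j => lee_eq_zero.1 (h j (Finset.mem_univ j)))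

lemma grayMap_injective : Function.Injective (grayMap : Amb 0 β → _) := fun x y h => by
  rw [← hammingDist_eq_zero, hammingDist_grayMap, leeWeight_eq_zero, sub_eq_zero] at h
  exact h

lemma minDistEq_grayMap_iff (C : AddSubgroup (Amb 0 β)) (d : ℕ) :
    minDistEq (grayMap '' (C : Set (Amb 0 β))) d ↔
      (∀ x ∈ C, x ≠ 0 → d ≤ leeWeight x) ∧ ∃ x ∈ C, x ≠ 0 ∧ leeWeight x = d := by
  constructor
  · rintro ⟨h, _, ⟨x, hx, rfl⟩, _, ⟨y, hy, rfl⟩, hxy, hd⟩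
    refine ⟨fun z hz hz0 => ?_, x - y, C.sub_mem hx hy, ?_, by rw [← hammingDist_grayMap, hd]⟩
    · have := h _ ⟨z, hz, rfl⟩ _ ⟨0, C.zero_mem, rfl⟩ (grayMap_injective.ne hz0)
      rwa [hammingDist_grayMap, sub_zero] at this
    · exact sub_ne_zero.2 fun e => hxy (congrArg _ e)
  · rintro ⟨h, x, hx, hx0, hd⟩
    refine ⟨?_, _, ⟨x, hx, rfl⟩, _, ⟨0, C.zero_mem, rfl⟩, grayMap_injective.ne hx0, ?_⟩
    · rintro _ ⟨x, hx, rfl⟩ _ ⟨y, hy, rfl⟩ hxy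
      rw [hammingDist_grayMap]
      exact h _ (C.sub_mem hx hy) (sub_ne_zero.2 fun e => hxy (congrArg _ e))
    · rw [hammingDist_grayMap, sub_zero, hd]

end LeeWeight

section Quadrupling

variable {β : ℕ}

/-- Sum of the four blocks of length `β`. -/
def fold (β : ℕ) : Amb 0 (4 * β) →+ Amb 0 β where
  toFun x := (0, fun j => ∑ k : Fin 4, x.2 (finProdFinEquiv (k, j)))
  map_zero' := by ext <;> simp
  map_add' x y := Prod.ext (Subsingleton.elim _ _) (funext fun j => by
    simp [Finset.sum_add_distrib])

/-- Fourfold repetition of a vector of length `β`. -/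
def repeatFour (β : ℕ) : Amb 0 β →+ Amb 0 (4 * β) where
  toFun x := (0, fun m => x.2 (finProdFinEquiv.symm m).2)
  map_zero' := by ext <;> simp
  map_add' x y := Prod.ext (Subsingleton.elim _ _) rfl

lemma fold_apply (x : Amb 0 (4 * β)) (j : Fin β) :
    (fold β x).2 j = ∑ k : Fin 4, x.2 (finProdFinEquiv (k, j)) := rfl

@[simp] lemma repeatFour_apply (x : Amb 0 β) (k : Fin 4) (j : Fin β) :
    (repeatFour β x).2 (finProdFinEquiv (k, j)) = x.2 j := by
  simp only [repeatFour, AddMonoidHom.coe_mk, ZeroHom.coe_mk, Equiv.symm_apply_apply]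

/-- The vector whose value at position `j` of block `k` is `π j k`. -/
def permVector (π : Fin β → Fin 4 ≃ Z4) : Amb 0 (4 * β) :=
  (0, fun m => π (finProdFinEquiv.symm m).2 (finProdFinEquiv.symm m).1)

@[simp] lemma permVector_apply (π : Fin β → Fin 4 ≃ Z4) (k : Fin 4) (j : Fin β) :
    (permVector π).2 (finProdFinEquiv (k, j)) = π j k := by
  simp only [permVector, Equiv.symm_apply_apply]

/-- The code with parity checks those of `C`, repeated four times, and `permVector π`. -/
def quadruple (π : Fin β → Fin 4 ≃ Z4) (C : AddSubgroup (Amb 0 β)) :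
    AddSubgroup (Amb 0 (4 * β)) :=
  C.comap (fold β) ⊓ (innerHom (permVector π)).ker

lemma sum_fin_four_mul {N : Type*} [AddCommMonoid N] (f : Fin (4 * β) → N) :
    ∑ m, f m = ∑ j, ∑ k : Fin 4, f (finProdFinEquiv (k, j)) := by
  rw [← finProdFinEquiv.sum_comp, Fintype.sum_prod_type, Finset.sum_comm]

/-- The vector whose value at position `j` of block `k` is `q j (π j k)`. -/
def ofFibers (π : Fin β → Fin 4 ≃ Z4) (q : Fin β → Z4 → Z4) : Amb 0 (4 * β) :=
  (0, fun m => q (finProdFinEquiv.symm m).2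
    (π (finProdFinEquiv.symm m).2 (finProdFinEquiv.symm m).1))

lemma ofFibers_apply (π : Fin β → Fin 4 ≃ Z4) (q : Fin β → Z4 → Z4) (k : Fin 4) (j : Fin β) :
    (ofFibers π q).2 (finProdFinEquiv (k, j)) = q j (π j k) := by
  simp only [ofFibers, Equiv.symm_apply_apply]

lemma ofFibers_surjective (π : Fin β → Fin 4 ≃ Z4) : Function.Surjective (ofFibers π) := by
  intro x
  refine ⟨fun j a => x.2 (finProdFinEquiv ((π j).symm a, j)), ?_⟩
  refine Prod.ext (Subsingleton.elim _ _) (funext fun m => ?_)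
  obtain ⟨⟨k, j⟩, rfl⟩ := finProdFinEquiv.surjective m
  rw [ofFibers_apply, Equiv.symm_apply_apply]

lemma fold_ofFibers (π : Fin β → Fin 4 ≃ Z4) (q : Fin β → Z4 → Z4) (j : Fin β) :
    (fold β (ofFibers π q)).2 j = ∑ a, q j a := by
  simp only [fold_apply, ofFibers_apply]
  exact (π j).sum_comp (q j)

lemma leeWeight_ofFibers (π : Fin β → Fin 4 ≃ Z4) (q : Fin β → Z4 → Z4) :
    leeWeight (ofFibers π q) = ∑ j, ∑ a, lee (q j a) := by
  simp only [leeWeight, sum_fin_four_mul, ofFibers_apply]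
  exact Finset.sum_congr rfl fun j _ => (π j).sum_comp fun a => lee (q j a)

lemma addInner_eq_sum {n : ℕ} (u v : Amb 0 n) : addInner u v = ∑ m, u.2 m * v.2 m := by
  simp [addInner]

lemma addInner_ofFibers (π : Fin β → Fin 4 ≃ Z4) (q : Fin β → Z4 → Z4) :
    addInner (ofFibers π q) (permVector π) = ∑ j, ∑ a, q j a * a := by
  simp only [addInner_eq_sum, sum_fin_four_mul, ofFibers_apply, permVector_apply]
  exact Finset.sum_congr rfl fun j _ => (π j).sum_comp fun a => q j a * a

lemma mem_quadruple_ofFibers {π : Fin β → Fin 4 ≃ Z4} {C : AddSubgroup (Amb 0 β)}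
    {q : Fin β → Z4 → Z4} : ofFibers π q ∈ quadruple π C ↔
      ((0, fun j => ∑ a, q j a) : Amb 0 β) ∈ C ∧ ∑ j, ∑ a, q j a * a = 0 := by
  rw [← addInner_ofFibers π,
    show ((0, fun j => ∑ a, q j a) : Amb 0 β) = fold β (ofFibers π q) from
      Prod.ext (Subsingleton.elim _ _) (funext fun j => (fold_ofFibers π q j).symm)]
  rfl

lemma prod_fold_innerHom_surjective (hβ : 0 < β) (π : Fin β → Fin 4 ≃ Z4) :
    Function.Surjective ((fold β).prod (innerHom (permVector π))) := by
  rintro ⟨y, s⟩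
  let o : Fin β := ⟨0, hβ⟩
  let c : Fin β → Z4 := Pi.single o s
  refine ⟨ofFibers π fun j a => if a = 0 then y.2 j - c j else if a = 1 then c j else 0, ?_⟩
  have h₁ : ∀ y c : Z4, ∑ a : Z4, (if a = 0 then y - c else if a = 1 then c else 0) = y := by
    decide
  have h₂ : ∀ y c : Z4, ∑ a : Z4, (if a = 0 then y - c else if a = 1 then c else 0) * a = c := by
    decide
  refine Prod.ext (Prod.ext (Subsingleton.elim _ _) (funext fun j => ?_)) ?_
  · exact (fold_ofFibers _ _ _).trans (h₁ _ _)
  · refine (addInner_ofFibers _ _).trans ?_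
    simp only [h₂, c, Finset.sum_pi_single', Finset.mem_univ, if_true]

lemma quadruple_eq_comap (π : Fin β → Fin 4 ≃ Z4) (C : AddSubgroup (Amb 0 β)) :
    quadruple π C = (C.prod ⊥).comap ((fold β).prod (innerHom (permVector π))) := by
  ext x
  simp [quadruple, AddSubgroup.mem_prod]

lemma index_quadruple (hβ : 0 < β) (π : Fin β → Fin 4 ≃ Z4) (C : AddSubgroup (Amb 0 β)) :
    (quadruple π C).index = C.index * 4 := by
  rw [quadruple_eq_comap, AddSubgroup.index_comap_of_surjective _
    (prod_fold_innerHom_surjective hβ π), AddSubgroup.index_prod, AddSubgroup.index_bot,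
    Nat.card_zmod]

lemma card_mul_index_eq_two_pow {n : ℕ} (C : AddSubgroup (Amb 0 n)) :
    Nat.card C * C.index = 2 ^ (2 * n) := by
  rw [C.card_mul_index, Nat.card_prod]
  simp [pow_mul]

lemma leeWeight_fold_le (x : Amb 0 (4 * β)) : leeWeight (fold β x) ≤ leeWeight x := by
  rw [leeWeight, leeWeight, sum_fin_four_mul]
  exact Finset.sum_le_sum fun j _ =>
    Finset.le_sum_of_subadditive lee le_rfl lee_add_le _ _

lemma sum_zmod_four {N : Type*} [AddCommMonoid N] (f : Z4 → N) :
    ∑ a, f a = f 0 + f 1 + f 2 + f 3 :=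
  Fin.sum_univ_four f

lemma two_le_sum_lee {q : Z4 → Z4} (h0 : ∑ a, q a = 0) (hq : q ≠ 0) : 2 ≤ ∑ a, lee (q a) := by
  have h : ∀ a b c d : Z4, a + b + c + d = 0 → 2 ≤ lee a + lee b + lee c + lee d ∨
      (a = 0 ∧ b = 0 ∧ c = 0 ∧ d = 0) := by decide
  rw [sum_zmod_four] at h0 ⊢
  refine (h _ _ _ _ h0).resolve_right fun ⟨h0, h1, h2, h3⟩ => hq (funext fun a => ?_)
  fin_cases a <;> assumption

lemma eq_zero_of_sum_lee_le_three {q : Z4 → Z4} (h0 : ∑ a, q a = 0) (h1 : ∑ a, q a * a = 0)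
    (h3 : ∑ a, lee (q a) ≤ 3) : q = 0 := by
  have h : ∀ a b c d : Z4, a + b + c + d = 0 → a * 0 + b * 1 + c * 2 + d * 3 = 0 →
      lee a + lee b + lee c + lee d ≤ 3 → (a = 0 ∧ b = 0 ∧ c = 0 ∧ d = 0) := by decide
  rw [sum_zmod_four] at h0 h1 h3
  obtain ⟨h0, h1, h2, h3⟩ := h _ _ _ _ h0 h1 h3
  funext a
  fin_cases a <;> assumption

lemma four_le_leeWeight_of_mem_quadruple {π : Fin β → Fin 4 ≃ Z4} {C : AddSubgroup (Amb 0 β)}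
    (hC : ∀ x ∈ C, x ≠ 0 → 4 ≤ leeWeight x) {x : Amb 0 (4 * β)} (hx : x ∈ quadruple π C)
    (hx0 : x ≠ 0) : 4 ≤ leeWeight x := by
  by_contra! hlt
  have hfold : fold β x = 0 := by
    by_contra hne
    have := (hC _ hx.1 hne).trans (leeWeight_fold_le x)
    omega
  obtain ⟨q, rfl⟩ := ofFibers_surjective π x
  have hsum : ∀ j, ∑ a, q j a = 0 := fun j => by rw [← fold_ofFibers π, hfold]; rfl
  have hinner := (mem_quadruple_ofFibers.1 hx).2
  rw [leeWeight_ofFibers] at hlt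
  obtain ⟨o, ho⟩ : ∃ o, q o ≠ 0 := by
    by_contra! h
    refine hx0 (leeWeight_eq_zero.1 ?_)
    rw [leeWeight_ofFibers]
    exact Finset.sum_eq_zero fun j _ => Finset.sum_eq_zero fun a _ => by rw [h j]; rfl
  have hother : ∀ j, j ≠ o → q j = 0 := by
    by_contra! ⟨j, hjo, hj⟩
    have h₁ := two_le_sum_lee (hsum j) hj
    have h₂ := two_le_sum_lee (hsum o) ho
    have h₃ := Finset.add_le_sum (f := fun j => ∑ a, lee (q j a)) (fun _ _ => Nat.zero_le _)
      (Finset.mem_univ j) (Finset.mem_univ o) hjo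
    omega
  refine ho (eq_zero_of_sum_lee_le_three (hsum o) ?_ ?_)
  · rwa [Fintype.sum_eq_single o fun j hj => by simp [hother j hj]] at hinner
  · have := Finset.single_le_sum (f := fun j => ∑ a, lee (q j a)) (fun _ _ => Nat.zero_le _)
      (Finset.mem_univ o)
    omega

lemma exists_leeWeight_eq_four (hβ : 0 < β) (π : Fin β → Fin 4 ≃ Z4)
    (C : AddSubgroup (Amb 0 β)) : ∃ x ∈ quadruple π C, x ≠ 0 ∧ leeWeight x = 4 := by
  let o : Fin β := ⟨0, hβ⟩
  let r : Z4 → Z4 := fun a => if a = 0 ∨ a = 3 then 1 else -1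
  let q : Fin β → Z4 → Z4 := Pi.single o r
  have hq : ∀ j, j ≠ o → q j = 0 := fun j hj => by simp [q, hj]
  have hqo : q o = r := by simp [q]
  have hw : leeWeight (ofFibers π q) = 4 := by
    rw [leeWeight_ofFibers, Fintype.sum_eq_single o, hqo]
    · decide
    · intro j hj
      exact Finset.sum_eq_zero fun a _ => by rw [hq j hj]; rfl
  refine ⟨ofFibers π q, mem_quadruple_ofFibers.2 ⟨?_, ?_⟩, fun h => ?_, hw⟩
  · convert C.zero_mem using 1
    refine Prod.ext (Subsingleton.elim _ _) (funext fun j => ?_)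
    change ∑ a, q j a = 0
    by_cases hj : j = o
    · rw [hj, hqo]
      decide
    · exact Finset.sum_eq_zero fun a _ => by rw [hq j hj]; rfl
  · rw [Fintype.sum_eq_single o, hqo]
    · decide
    · intro j hj
      simp [hq j hj]
  · rw [h, leeWeight_zero] at hw
    omega

lemma isQuatPerfect.quadruple {t : ℕ} {C : AddSubgroup (Amb 0 β)} (h : isQuatPerfect t β C)
    (π : Fin β → Fin 4 ≃ Z4) : isQuatPerfect (t + 2) (4 * β) (quadruple π C) := by
  obtain ⟨ht, hβ, hcard, hmin⟩ := h
  have hβ0 : 0 < β := by rw [hβ]; positivity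
  have ht1 : 2 * β = 2 ^ t := by rw [hβ, ← pow_succ']; congr 1; omega
  have hlt : t < 2 * β := ht1 ▸ Nat.lt_two_pow_self
  rw [minDistEq_grayMap_iff] at hmin
  rw [Nat.card_image_of_injective grayMap_injective] at hcard
  refine ⟨by omega, ?_, ?_, (minDistEq_grayMap_iff _ _).2
    ⟨fun x hx hx0 => four_le_leeWeight_of_mem_quadruple hmin.1 hx hx0,
      exists_leeWeight_eq_four hβ0 π C⟩⟩
  · rw [hβ, show t + 2 - 1 = t - 1 + 2 by omega, pow_add]
    ring
  · rw [Nat.card_image_of_injective grayMap_injective]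
    have hC : C.index = 2 ^ (t + 1) := by
      have h := card_mul_index_eq_two_pow C
      rw [show Nat.card C = _ from hcard,
        show 2 * β = (2 * β - t - 1) + (t + 1) by omega, pow_add] at h
      have h' : 2 * β - t - 1 + (t + 1) - t - 1 = 2 * β - t - 1 := by omega
      rw [h'] at h
      exact Nat.eq_of_mul_eq_mul_left (by positivity) h
    have h := card_mul_index_eq_two_pow (_root_.quadruple π C)
    rw [index_quadruple hβ0, hC, show 2 ^ (t + 1) * 4 = 2 ^ (t + 3) by ring,
      show 2 * (4 * β) = (2 * (4 * β) - (t + 2) - 1) + (t + 3) by omega,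
      pow_add _ (2 * (4 * β) - (t + 2) - 1)] at h
    exact Nat.eq_of_mul_eq_mul_right (show 0 < 2 ^ (t + 3) by positivity) h

end Quadrupling

section DualTypes

variable {β : ℕ}

lemma repeatFour_injective (β : ℕ) : Function.Injective (repeatFour β) := fun x y h => by
  refine Prod.ext (Subsingleton.elim _ _) (funext fun j => ?_)
  rw [← repeatFour_apply x 0 j, h, repeatFour_apply]

lemma addInner_repeatFour (x : Amb 0 (4 * β)) (h : Amb 0 β) :
    addInner (repeatFour β h) x = addInner h (fold β x) := by
  simp only [addInner_eq_sum, sum_fin_four_mul, repeatFour_apply, fold_apply, Finset.mul_sum]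

/-- The standard basis vectors of `Z₄^n`. -/
def basisVector {n : ℕ} (m : Fin n) : Amb 0 n := (0, Pi.single m 1)

lemma addInner_basisVector {n : ℕ} (u : Amb 0 n) (m : Fin n) :
    addInner u (basisVector m) = u.2 m := by
  simp [addInner_eq_sum, basisVector, Pi.single_apply]

lemma fold_basisVector (k : Fin 4) (j : Fin β) :
    fold β (basisVector (finProdFinEquiv (k, j))) = basisVector j := by
  refine Prod.ext (Subsingleton.elim _ _) (funext fun i => ?_)
  simp only [fold_apply, basisVector, Pi.single_apply, EmbeddingLike.apply_eq_iff_eq,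
    Prod.mk.injEq]
  by_cases hij : i = j <;> simp [hij]

lemma fold_surjective (β : ℕ) : Function.Surjective (fold β) := fun y => by
  refine ⟨(0, fun m => if (finProdFinEquiv.symm m).1 = 0 then
    y.2 (finProdFinEquiv.symm m).2 else 0), ?_⟩
  refine Prod.ext (Subsingleton.elim _ _) (funext fun j => ?_)
  simp only [fold_apply, Equiv.symm_apply_apply, Finset.sum_ite_eq', Finset.mem_univ, if_true]

lemma dualCode_comap_fold (C : AddSubgroup (Amb 0 β)) :
    dualCode (C.comap (fold β)) = (dualCode C).map (repeatFour β) := by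
  ext u
  constructor
  · intro hu
    have hconst : ∀ k j, u.2 (finProdFinEquiv (k, j)) = u.2 (finProdFinEquiv (0, j)) := by
      intro k j
      have h := hu (basisVector (finProdFinEquiv (k, j)) - basisVector (finProdFinEquiv (0, j)))
        (by rw [AddSubgroup.mem_comap, map_sub, fold_basisVector, fold_basisVector, sub_self]
            exact C.zero_mem)
      rwa [addInner_comm, ← innerHom_apply, map_sub, innerHom_apply, innerHom_apply,
        addInner_comm, addInner_comm _ u, addInner_basisVector, addInner_basisVector,
        sub_eq_zero] at h
    have hrep : repeatFour β (0, fun j => u.2 (finProdFinEquiv (0, j))) = u := by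
      refine Prod.ext (Subsingleton.elim _ _) (funext fun m => ?_)
      obtain ⟨⟨k, j⟩, rfl⟩ := finProdFinEquiv.surjective m
      rw [repeatFour_apply, hconst k j]
    refine ⟨_, fun v hv => ?_, hrep⟩
    obtain ⟨x, rfl⟩ := fold_surjective β v
    rw [← addInner_repeatFour, hrep]
    exact hu x hv
  · rintro ⟨h, hh, rfl⟩ x hx
    rw [addInner_repeatFour]
    exact hh _ hx

lemma dualCode_quadruple (π : Fin β → Fin 4 ≃ Z4) (C : AddSubgroup (Amb 0 β)) :
    dualCode (quadruple π C) =
      (dualCode C).map (repeatFour β) ⊔ AddSubgroup.zmultiples (permVector π) := by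
  rw [quadruple, dualCode_inf_ker, dualCode_comap_fold]

lemma dualCode_quadruple_inf (π ρ : Fin β → Fin 4 ≃ Z4) (C₁ C₂ : AddSubgroup (Amb 0 β)) :
    dualCode (quadruple π C₁ ⊓ quadruple ρ C₂) =
      (dualCode (C₁ ⊓ C₂)).map (repeatFour β) ⊔ AddSubgroup.zmultiples (permVector π) ⊔
        AddSubgroup.zmultiples (permVector ρ) := by
  rw [← dualCode_comap_fold, ← dualCode_inf_ker, ← dualCode_inf_ker, quadruple, quadruple,
    AddSubgroup.comap_inf, inf_inf_inf_comm, inf_assoc (_ ⊓ _)]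

lemma four_nsmul_eq_zero {n : ℕ} (x : Amb 0 n) : (4 : ℕ) • x = 0 := by
  have h : ∀ a : Z4, (4 : ℕ) • a = 0 := by decide
  exact Prod.ext (Subsingleton.elim _ _) (funext fun m => h (x.2 m))

lemma two_nsmul_permVector_notMem (hβ : 0 < β) (π : Fin β → Fin 4 ≃ Z4)
    (A : AddSubgroup (Amb 0 β)) : (2 : ℕ) • permVector π ∉ A.map (repeatFour β) := by
  rintro ⟨h, -, hh⟩
  let o : Fin β := ⟨0, hβ⟩
  have hval : ∀ a : Z4, h.2 o = 2 • a := fun a => by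
    rw [← repeatFour_apply h ((π o).symm a) o, hh]
    simp
  exact absurd ((hval 0).symm.trans (hval 1)) (by decide)

lemma isOfType.dualCode_quadruple (hβ : 0 < β) (π : Fin β → Fin 4 ≃ Z4)
    {C : AddSubgroup (Amb 0 β)} {γ δ : ℕ} (hC : isOfType (dualCode C) γ δ) :
    isOfType (dualCode (quadruple π C)) γ (δ + 1) := by
  rw [_root_.dualCode_quadruple]
  exact (hC.map (repeatFour_injective β)).sup_zmultiples_of_order_four (four_nsmul_eq_zero _)
    (two_nsmul_permVector_notMem hβ π _)

/-- The identity labelling of the four blocks by `Z₄`. -/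
def idLabel : Fin 4 ≃ Z4 := Equiv.refl (Fin 4)

lemma exists_inf_type_succ (hβ : 0 < β) {C₁ C₂ : AddSubgroup (Amb 0 β)} {i j : ℕ}
    (h : isOfType (dualCode (C₁ ⊓ C₂)) i j) :
    ∃ π ρ : Fin β → Fin 4 ≃ Z4,
      isOfType (dualCode (quadruple π C₁ ⊓ quadruple ρ C₂)) i (j + 1) := by
  refine ⟨fun _ => idLabel, fun _ => idLabel, ?_⟩
  rw [dualCode_quadruple_inf, sup_assoc, sup_idem, ← dualCode_quadruple]
  exact h.dualCode_quadruple hβ _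

lemma exists_inf_type_add_two (hβ : 0 < β) {C₁ C₂ : AddSubgroup (Amb 0 β)} {i j : ℕ}
    (h : isOfType (dualCode (C₁ ⊓ C₂)) i j) :
    ∃ π ρ : Fin β → Fin 4 ≃ Z4,
      isOfType (dualCode (quadruple π C₁ ⊓ quadruple ρ C₂)) i (j + 2) := by
  let τ : Fin 4 ≃ Z4 := idLabel.trans (Equiv.swap 1 2)
  refine ⟨fun _ => idLabel, fun _ => τ, ?_⟩
  rw [dualCode_quadruple_inf, ← dualCode_quadruple]
  refine (h.dualCode_quadruple hβ _).sup_zmultiples_of_order_four (four_nsmul_eq_zero _) ?_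
  rw [dualCode_quadruple, AddSubgroup.mem_sup]
  rintro ⟨_, ⟨y, -, rfl⟩, _, ⟨n, rfl⟩, hn⟩
  let o : Fin β := ⟨0, hβ⟩
  have hval : ∀ k : Fin 4, y.2 o + (n : Z4) * idLabel k = 2 * τ k := fun k => by
    have := congrArg (fun z : Amb 0 (4 * β) => z.2 (finProdFinEquiv (k, o))) hn
    simpa using this
  have key : ∀ c m : Z4, ¬ ∀ k : Fin 4, c + m * idLabel k = 2 * τ k := by decide
  exact key _ _ hval

lemma exists_inf_type_succ_succ (hβ : 1 < β) {C₁ C₂ : AddSubgroup (Amb 0 β)} {i j : ℕ}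
    (h : isOfType (dualCode (C₁ ⊓ C₂)) i j) :
    ∃ π ρ : Fin β → Fin 4 ≃ Z4,
      isOfType (dualCode (quadruple π C₁ ⊓ quadruple ρ C₂)) (i + 1) (j + 1) := by
  let o : Fin β := ⟨0, by omega⟩
  let o' : Fin β := ⟨1, hβ⟩
  let ν : Fin 4 ≃ Z4 := idLabel.trans (Equiv.neg Z4)
  let π : Fin β → Fin 4 ≃ Z4 := fun _ => idLabel
  let ρ : Fin β → Fin 4 ≃ Z4 := fun l => if l = o then ν else idLabel
  refine ⟨π, ρ, ?_⟩
  have hsup : AddSubgroup.zmultiples (permVector π) ⊔ AddSubgroup.zmultiples (permVector ρ) =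
      AddSubgroup.zmultiples (permVector π) ⊔
        AddSubgroup.zmultiples (permVector ρ - permVector π) := by
    apply le_antisymm <;> refine sup_le le_sup_left ?_ <;> rw [AddSubgroup.zmultiples_le]
    · rw [← add_sub_cancel (permVector π) (permVector ρ)]
      exact AddSubgroup.add_mem_sup (AddSubgroup.mem_zmultiples _)
        (by simp)
    · exact AddSubgroup.sub_mem _
        (AddSubgroup.mem_sup_right (AddSubgroup.mem_zmultiples _))
        (AddSubgroup.mem_sup_left (AddSubgroup.mem_zmultiples _))
  have hdiff : ∀ k l, (permVector ρ - permVector π).2 (finProdFinEquiv (k, l)) =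
      (if l = o then ν k else idLabel k) - idLabel k := fun k l => by
    rw [Prod.snd_sub, Pi.sub_apply, permVector_apply, permVector_apply]
    simp only [ρ, π]
    split_ifs <;> rfl
  rw [dualCode_quadruple_inf, sup_assoc, hsup, ← sup_assoc, ← dualCode_quadruple]
  refine (h.dualCode_quadruple (by omega) _).sup_zmultiples_of_order_two ?_ ?_
  · refine Prod.ext (Subsingleton.elim _ _) (funext fun m => ?_)
    obtain ⟨⟨k, l⟩, rfl⟩ := finProdFinEquiv.surjective m
    have hν : ∀ k, (2 : ℕ) • (ν k - idLabel k) = 0 := by decide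
    change (2 : ℕ) • (permVector ρ - permVector π).2 (finProdFinEquiv (k, l)) = 0
    rw [hdiff]
    split_ifs
    · exact hν k
    · rw [sub_self, smul_zero]
  · rw [dualCode_quadruple, AddSubgroup.mem_sup]
    rintro ⟨_, ⟨y, -, rfl⟩, _, ⟨n, rfl⟩, hn⟩
    have hval : ∀ k l, y.2 l + (n : Z4) * idLabel k =
        (if l = o then ν k else idLabel k) - idLabel k := fun k l => by
      have := congrArg (fun z : Amb 0 (4 * β) => z.2 (finProdFinEquiv (k, l))) hn
      simp only [hdiff] at this
      simpa [π] using this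
    have ho : ∀ k, y.2 o + (n : Z4) * idLabel k = ν k - idLabel k := fun k => by
      simpa using hval k o
    have ho' : ∀ k, y.2 o' + (n : Z4) * idLabel k = 0 := fun k => by
      simpa [o, o'] using hval k o'
    have key : ∀ c c' m : Z4, (∀ k, c + m * idLabel k = ν k - idLabel k) →
        ¬ ∀ k, c' + m * idLabel k = 0 := by decide
    exact key _ _ _ ho ho'

end DualTypes

/-- quadrupling construction for the `δ` parameter of the intersection's
dual type. -/
theorem stmt9 {t β γ₁ δ₁ γ₂ δ₂ i j : ℕ} (ht : 3 ≤ t) (hβ : β = 2 ^ (t - 1))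
    (C₁ C₂ : AddSubgroup (Amb 0 β))
    (h₁ : isQuatPerfect t β C₁) (h₂ : isQuatPerfect t β C₂)
    (hd₁ : isOfType (dualCode C₁) γ₁ δ₁) (hd₂ : isOfType (dualCode C₂) γ₂ δ₂)
    (hint : isOfType (dualCode (C₁ ⊓ C₂)) i j) :
    ∀ p ∈ ({(i, j + 1), (i, j + 2), (i + 1, j + 1)} : Set (ℕ × ℕ)),
      ∃ D₁ D₂ : AddSubgroup (Amb 0 (4 * β)),
        isQuatPerfect (t + 2) (4 * β) D₁ ∧ isQuatPerfect (t + 2) (4 * β) D₂ ∧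
        isOfType (dualCode D₁) γ₁ (δ₁ + 1) ∧ isOfType (dualCode D₂) γ₂ (δ₂ + 1) ∧
        isOfType (dualCode (D₁ ⊓ D₂)) p.1 p.2 := by
  have hβ1 : 1 < β := by
    rw [hβ]
    exact Nat.one_lt_two_pow (by omega)
  have hβ0 : 0 < β := by omega
  have reduce : ∀ i' j', (∃ π ρ : Fin β → Fin 4 ≃ Z4,
      isOfType (dualCode (quadruple π C₁ ⊓ quadruple ρ C₂)) i' j') →
      ∃ D₁ D₂ : AddSubgroup (Amb 0 (4 * β)),
        isQuatPerfect (t + 2) (4 * β) D₁ ∧ isQuatPerfect (t + 2) (4 * β) D₂ ∧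
        isOfType (dualCode D₁) γ₁ (δ₁ + 1) ∧ isOfType (dualCode D₂) γ₂ (δ₂ + 1) ∧
        isOfType (dualCode (D₁ ⊓ D₂)) i' j' := by
    rintro i' j' ⟨π, ρ, h⟩
    exact ⟨_, _, h₁.quadruple π, h₂.quadruple ρ, hd₁.dualCode_quadruple hβ0 π,
      hd₂.dualCode_quadruple hβ0 ρ, h⟩
  rintro p (rfl | rfl | rfl)
  · exact reduce _ _ (exists_inf_type_succ hβ0 hint)
  · exact reduce _ _ (exists_inf_type_add_two hβ0 hint)
  · exact reduce _ _ (exists_inf_type_succ_succ hβ1 hint)
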